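/- Let a be the transposition exchanging the elements 0 and 1 of the five-element set {0,1,2,3,4}, let b be the transposition exchanging 2 and 3, and let P ⊆ Σ_5 be the subgroup generated by a and b (so P ≅ C_2 × C_2). Give V = 𝔽_2^5 the permutation action of P induced by its action on the five coordinates, and let 𝔽_2[P] be the group algebra with the left regular P-action. Then there is no injective 𝔽_2-linear P-equivariant map φ : 𝔽_2[P] → V; indeed, every P-equivariant 𝔽_2-linear map φ : 𝔽_2[P] → V satisfies φ(e + a + b + ab) = 0, while e + a + b + ab ≠ 0 in 𝔽_2[P]. (Consequently the 𝔽_2[P]-module 𝔽_2^5 contains no submodule isomorphic to the free module 𝔽_2[P].) -/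

import Mathlib

/-- The transposition (0 1) in Σ_5. -/
def aPerm : Equiv.Perm (Fin 5) := Equiv.swap 0 1

/-- The transposition (2 3) in Σ_5. -/
def bPerm : Equiv.Perm (Fin 5) := Equiv.swap 2 3

/-- P = ⟨a, b⟩ ⊆ Σ_5, isomorphic to C_2 × C_2. -/
def Psub : Subgroup (Equiv.Perm (Fin 5)) := Subgroup.closure {aPerm, bPerm}

def aP : Psub := ⟨aPerm, Subgroup.subset_closure (by simp)⟩

def bP : Psub := ⟨bPerm, Subgroup.subset_closure (by simp)⟩

/-- The element e + a + b + ab of the group algebra 𝔽_2[P]. -/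
noncomputable def omegaEl : MonoidAlgebra (ZMod 2) Psub :=
  MonoidAlgebra.single 1 1 + MonoidAlgebra.single aP 1 +
    MonoidAlgebra.single bP 1 + MonoidAlgebra.single (aP * bP) 1

theorem omegaEl_ne_zero : omegaEl ≠ 0 := by
  have ha : aP ≠ 1 := fun h => absurd (congrArg Subtype.val h) (by decide)
  have hb : bP ≠ 1 := fun h => absurd (congrArg Subtype.val h) (by decide)
  have hab : aP * bP ≠ 1 := fun h => absurd (congrArg Subtype.val h) (by decide)
  intro h
  have h1 := congrArg (fun x : MonoidAlgebra (ZMod 2) Psub => x.coeff 1) h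
  simp [omegaEl, ha, hb, hab] at h1

theorem map_omegaEl_eq_zero (φ : MonoidAlgebra (ZMod 2) Psub →ₗ[ZMod 2] (Fin 5 → ZMod 2))
    (hφ : ∀ (g : Psub) (x : MonoidAlgebra (ZMod 2) Psub),
      φ (MonoidAlgebra.single g 1 * x) =
        fun i => φ x (((g : Equiv.Perm (Fin 5)))⁻¹ i)) :
    φ omegaEl = 0 := by
  have key (g : Psub) (i : Fin 5) : φ (MonoidAlgebra.single g 1) i =
      φ (MonoidAlgebra.single 1 1) ((g : Equiv.Perm (Fin 5))⁻¹ i) := by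
    simpa [MonoidAlgebra.single_mul_single] using
      congrFun (hφ g (MonoidAlgebra.single 1 1)) i
  have perms : ∀ (v : Fin 5 → ZMod 2) (i : Fin 5),
      v ((1 : Equiv.Perm (Fin 5))⁻¹ i) + v (aPerm⁻¹ i) + v (bPerm⁻¹ i) +
        v ((aPerm * bPerm)⁻¹ i) = 0 := by
    decide
  funext i
  simp only [omegaEl, map_add, Pi.add_apply, Pi.zero_apply]
  rw [key aP, key bP, key (aP * bP)]
  exact perms (φ (MonoidAlgebra.single 1 1)) i

/-- The element e + a + b + ab is nonzero in 𝔽_2[P], yet every P-equivariant 𝔽_2-linear map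
φ : 𝔽_2[P] → 𝔽_2^5 (with 𝔽_2[P] carrying the left regular action and 𝔽_2^5 the permutation
action) kills it; consequently no such map is injective. -/
theorem stmt9 :
    omegaEl ≠ 0 ∧
    ∀ φ : MonoidAlgebra (ZMod 2) Psub →ₗ[ZMod 2] (Fin 5 → ZMod 2),
      (∀ (g : Psub) (x : MonoidAlgebra (ZMod 2) Psub),
        φ (MonoidAlgebra.single g 1 * x) =
          fun i => φ x (((g : Equiv.Perm (Fin 5)))⁻¹ i)) →
      φ omegaEl = 0 ∧ ¬ Function.Injective φ :=
  ⟨omegaEl_ne_zero, fun φ hφ => ⟨map_omegaEl_eq_zero φ hφ, fun hinj =>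
    omegaEl_ne_zero (hinj ((map_omegaEl_eq_zero φ hφ).trans (map_zero φ).symm))⟩⟩
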